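/- Let V₁ and V₃ be representations of G, let h ∈ G, and let F ∈ Hom_U(ind_U^G(V₁), V₃) vanish on ind_U^{UhU}(V₁). Then 𝒥'(F) vanishes on ind_U^{Uh⁻¹U}(V₁). Consequently 𝒥' maps the subspace Hom_U^{fin}(ind_U^G(V₁), V₃) into itself. -/

import Mathlib

/-- The transformation rule of functions in `Ind_U^G(V)`:
`f (g * u) = u⁻¹ • f g` for all `g ∈ G` and `u ∈ U`. -/
def IsInd {G V : Type*} [Group G] (U : Subgroup G) [SMul G V] (f : G → V) : Prop :=
  ∀ g : G, ∀ u ∈ U, f (g * u) = u⁻¹ • f g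

/-- `α : V₁ → (G → V₂)` is a `U`-equivariant `k`-linear map `V₁ → Ind_U^G(V₂)`:
it is `k`-linear, takes values in `Ind_U^G(V₂)`, and is `U`-equivariant for the
`G`-action `(g • f) x = f (g⁻¹ * x)` on the induced representation. -/
def IsIndHom (k : Type*) {G V₁ V₂ : Type*} [Semiring k] [Group G] (U : Subgroup G)
    [AddCommMonoid V₁] [Module k V₁] [SMul G V₁]
    [AddCommMonoid V₂] [Module k V₂] [SMul G V₂] (α : V₁ → G → V₂) : Prop :=
  (∀ (c : k) (x y : V₁), α (c • x + y) = c • α x + α y) ∧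
  (∀ x : V₁, IsInd U (α x)) ∧
  (∀ u ∈ U, ∀ (x : V₁) (g : G), α (u • x) g = α x (u⁻¹ * g))

/-- The map `𝒥`, `𝒥(α) x g = g⁻¹ • (α (g⁻¹ • x) g⁻¹)`. -/
def Jmap {G V₁ V₂ : Type*} [Group G] [SMul G V₁] [SMul G V₂]
    (α : V₁ → G → V₂) : V₁ → G → V₂ :=
  fun x g => g⁻¹ • α (g⁻¹ • x) g⁻¹

/-- `f : G → V` is supported in finitely many left cosets of `U`. -/
def FinSupp {G V : Type*} [Group G] (U : Subgroup G) [Zero V] (f : G → V) : Prop :=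
  ∃ S : Finset G, ∀ g : G, f g ≠ 0 → ∃ s ∈ S, s⁻¹ * g ∈ U

/-- `f` lies in the compact induction `ind_U^G(V)`. -/
def IsCInd {G V : Type*} [Group G] (U : Subgroup G) [Zero V] [SMul G V] (f : G → V) : Prop :=
  IsInd U f ∧ FinSupp U f

open Classical in
/-- `char_{h,U}^v ∈ ind_U^G(V)`: the function supported on `hU` with
`char_{h,U}^v (h * u) = u⁻¹ • v`. -/
noncomputable def charFn {G V : Type*} [Group G] (U : Subgroup G) [Zero V] [SMul G V]
    (h : G) (v : V) : G → V :=
  fun g => if g⁻¹ * h ∈ U then (g⁻¹ * h) • v else 0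

/-- `rec(α)(φ) = Σ_{g ∈ G/U} α (φ g) g⁻¹`, the sum running over representatives of the
left cosets of `U` in `G`. -/
noncomputable def recMap {G V₁ V₂ : Type*} [Group G] (U : Subgroup G) [AddCommMonoid V₁]
    (α : V₂ → G → V₁) (φ : G → V₂) : V₁ :=
  ∑ᶠ q : G ⧸ U, α (φ q.out) q.out⁻¹


/-- `lam : (G → V) → W` represents a `U`-equivariant `k`-linear map
`ind_U^G(V) → W` (its values off the compact induction are irrelevant). -/
def IsCIndHom (k : Type*) {G V W : Type*} [Semiring k] [Group G] (U : Subgroup G)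
    [AddCommMonoid V] [Module k V] [SMul G V]
    [AddCommMonoid W] [Module k W] [SMul G W] (lam : (G → V) → W) : Prop :=
  (∀ (c : k) (φ ψ : G → V), IsCInd U φ → IsCInd U ψ →
      lam (c • φ + ψ) = c • lam φ + lam ψ) ∧
  (∀ u ∈ U, ∀ φ : G → V, IsCInd U φ → lam (fun g => φ (u⁻¹ * g)) = u • lam φ)

/-- `𝒥'(λ)(φ) = Σ_{g ∈ G/U} g • λ(char_{g⁻¹,U}^{g • φ g})`, the sum running over
representatives of the left cosets of `U` in `G`. -/
noncomputable def J'map {G V W : Type*} [Group G] (U : Subgroup G)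
    [Zero V] [SMul G V] [AddCommMonoid W] [SMul G W]
    (lam : (G → V) → W) (φ : G → V) : W :=
  ∑ᶠ q : G ⧸ U, q.out • lam (charFn U q.out⁻¹ (q.out • φ q.out))


/-- The double coset `UhU`. -/
def DCoset {G : Type*} [Group G] (U : Subgroup G) (h : G) : Set G :=
  {g | ∃ u₁ ∈ U, ∃ u₂ ∈ U, g = u₁ * h * u₂}

/-- `f` has support contained in `X`. -/
def SuppIn {G V : Type*} [Zero V] (X : Set G) (f : G → V) : Prop :=
  ∀ g, f g ≠ 0 → g ∈ X

/-- `F` represents an element of `Hom_U^{fin}(ind_U^G(V), W)`: there is a finite set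
`S ⊆ G` such that `F` vanishes on every `φ ∈ ind_U^G(V)` supported outside
`⋃_{h ∈ S} UhU`. -/
def HomFinSupp {G V W : Type*} [Group G] (U : Subgroup G) [Zero V] [SMul G V] [Zero W]
    (F : (G → V) → W) : Prop :=
  ∃ S : Finset G, ∀ φ : G → V, IsCInd U φ →
    (∀ g : G, φ g ≠ 0 → ∀ s ∈ S, g ∉ DCoset U s) → F φ = 0

theorem charFn_isCInd {G V : Type*} [Group G] (U : Subgroup G) [AddCommGroup V]
    [DistribMulAction G V] (h : G) (v : V) : IsCInd U (charFn U h v) := by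
  constructor
  · intro g u hu
    have e : (g * u)⁻¹ * h = u⁻¹ * (g⁻¹ * h) := by group
    have hiff : u⁻¹ * (g⁻¹ * h) ∈ U ↔ g⁻¹ * h ∈ U := U.mul_mem_cancel_left (U.inv_mem hu)
    unfold charFn
    rw [e]
    by_cases hm : g⁻¹ * h ∈ U
    · rw [if_pos hm, if_pos (hiff.2 hm), mul_smul]
    · rw [if_neg hm, if_neg (fun h' => hm (hiff.1 h')), smul_zero]
  · refine ⟨{h}, fun g hg => ⟨h, by simp, ?_⟩⟩
    by_contra hn
    apply hg
    unfold charFn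
    rw [if_neg]
    intro hm
    apply hn
    have := U.inv_mem hm
    simpa using this

theorem charFn_supp {G V : Type*} [Group G] (U : Subgroup G) [AddCommGroup V]
    [DistribMulAction G V] (h : G) (v : V) (g : G) (hg : charFn U h v g ≠ 0) :
    g⁻¹ * h ∈ U := by
  by_contra hn
  apply hg
  unfold charFn
  rw [if_neg hn]

theorem J'map_eq_zero {k G V₁ V₃ : Type*} [Field k] [Group G] (U : Subgroup G)
    [AddCommGroup V₁] [Module k V₁] [DistribMulAction G V₁]
    [AddCommGroup V₃] [Module k V₃] [DistribMulAction G V₃]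
    (F : (G → V₁) → V₃) (hF : IsCIndHom k U F) (φ : G → V₁)
    (H : ∀ g, φ g ≠ 0 → ∀ v, F (charFn U g⁻¹ v) = 0) : J'map U F φ = 0 := by
  unfold J'map
  apply finsum_eq_zero_of_forall_eq_zero
  intro q
  by_cases h0 : φ q.out = 0
  · have hz : IsCInd U (0 : G → V₁) :=
      ⟨fun g u _ => by simp, ⟨∅, fun g hg => absurd rfl hg⟩⟩
    have hF0 : F 0 = 0 := by
      have := hF.1 1 0 0 hz hz
      simpa using this
    have hc : charFn U q.out⁻¹ (q.out • φ q.out) = 0 := by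
      funext g
      simp [charFn, h0]
    rw [hc, hF0, smul_zero]
  · rw [H _ h0, smul_zero]

/-- If `F ∈ Hom_U(ind_U^G(V₁), V₃)` vanishes on `ind_U^{UhU}(V₁)`, then `𝒥'(F)` vanishes
on `ind_U^{Uh⁻¹U}(V₁)`; consequently `𝒥'` maps `Hom_U^{fin}(ind_U^G(V₁), V₃)` into
itself. -/
theorem stmt15 {k G V₁ V₃ : Type*} [Field k] [Group G] (U : Subgroup G)
    [AddCommGroup V₁] [Module k V₁] [DistribMulAction G V₁] [SMulCommClass G k V₁]
    [AddCommGroup V₃] [Module k V₃] [DistribMulAction G V₃] [SMulCommClass G k V₃]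
    (F : (G → V₁) → V₃) (hF : IsCIndHom k U F) :
    (∀ h : G,
      (∀ φ : G → V₁, IsCInd U φ → SuppIn (DCoset U h) φ → F φ = 0) →
      ∀ φ : G → V₁, IsCInd U φ → SuppIn (DCoset U h⁻¹) φ → J'map U F φ = 0) ∧
    (HomFinSupp U F → HomFinSupp U (J'map U F)) := by
  constructor
  · intro h hv φ _ hs
    refine J'map_eq_zero U F hF φ fun g hg v => hv _ (charFn_isCInd U _ v) fun x hx => ?_
    obtain ⟨u₁, h₁, u₂, h₂, rfl⟩ := hs g hg
    have hx' := charFn_supp U _ v x hx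
    refine ⟨u₂⁻¹, U.inv_mem h₂, u₁⁻¹ * (x⁻¹ * (u₁ * h⁻¹ * u₂)⁻¹)⁻¹,
      U.mul_mem (U.inv_mem h₁) (U.inv_mem hx'), ?_⟩
    group
  · rintro ⟨S, hS⟩
    classical
    refine ⟨S.image (fun s => s⁻¹), fun φ _ hφ => ?_⟩
    refine J'map_eq_zero U F hF φ fun g hg v => hS _ (charFn_isCInd U _ v) ?_
    intro x hx s hs hxs
    refine hφ g hg s⁻¹ (Finset.mem_image_of_mem _ hs) ?_
    have hx' := charFn_supp U _ v x hx
    obtain ⟨u₁, h₁, u₂, h₂, rfl⟩ := hxs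
    refine ⟨((u₁ * s * u₂)⁻¹ * g⁻¹)⁻¹ * u₂⁻¹,
      U.mul_mem (U.inv_mem hx') (U.inv_mem h₂), u₁⁻¹, U.inv_mem h₁, ?_⟩
    group
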